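/- Let n be an integer with 3 ≤ n ≤ 9 and set μ = √((n−2)(10−n)). Define, for t > 0 large, φ(t) = ln((n−2)/t) + ln(1 + (ln t)/(2t)), f(t) = ln(2t + φ(t)), F₀(t) = e^{φ(t)} + f''(t) − (n−2)f'(t), F₁(t) = e^{φ(t)}(2t + φ(t)) − 2(n−2), F₂(t, η) = e^{φ(t)}(e^η − η − 1)(2t + φ(t)), F₃(t, η) = e^{φ(t)}( exp((e^η − 1)(2t + φ(t))) − (e^η − 1)(2t + φ(t)) − 1 ), and F(t, η) = F₁(t)·η + F₂(t, η) + F₃(t, η) + F₀(t). For T > 0 let X_T be the space of continuous functions η on (T, ∞) with ‖η‖ := sup_{t>T} t²|η(t)| < ∞, and Σ_M = {η ∈ X_T : ‖η‖ ≤ M}. Define Ψ[η](t) = −(1/μ) e^{(n−2)t/2} ∫_t^∞ e^{−(n−2)s/2} sin(μ(s−t)) F(s, η(s)) ds. Then there exist M, T > 0 such that Ψ maps Σ_M into Σ_M and there exists 0 ≤ q < 1 with ‖Ψ[η₁] − Ψ[η₂]‖ ≤ q·‖η₁ − η₂‖ for all η₁, η₂ ∈ Σ_M. -/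

import Mathlib

open MeasureTheory

/-- `φ(t) = ln((n-2)/t) + ln(1 + (ln t)/(2t))`. -/
noncomputable def phiFn (n : ℕ) (t : ℝ) : ℝ :=
  Real.log (((n : ℝ) - 2) / t) + Real.log (1 + Real.log t / (2 * t))

/-- `f(t) = ln(2t + φ(t))`. -/
noncomputable def fFn (n : ℕ) (t : ℝ) : ℝ := Real.log (2 * t + phiFn n t)

/-- `F₀(t) = e^{φ(t)} + f''(t) - (n-2) f'(t)`. -/
noncomputable def F0Fn (n : ℕ) (t : ℝ) : ℝ :=
  Real.exp (phiFn n t) + deriv (deriv (fFn n)) t - ((n : ℝ) - 2) * deriv (fFn n) t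

/-- `F₁(t) = e^{φ(t)} (2t + φ(t)) - 2(n-2)`. -/
noncomputable def F1Fn (n : ℕ) (t : ℝ) : ℝ :=
  Real.exp (phiFn n t) * (2 * t + phiFn n t) - 2 * ((n : ℝ) - 2)

/-- `F₂(t, η) = e^{φ(t)} (e^η - η - 1)(2t + φ(t))`. -/
noncomputable def F2Fn (n : ℕ) (t η : ℝ) : ℝ :=
  Real.exp (phiFn n t) * (Real.exp η - η - 1) * (2 * t + phiFn n t)

/-- `F₃(t, η) = e^{φ(t)} ( exp((e^η - 1)(2t + φ(t))) - (e^η - 1)(2t + φ(t)) - 1 )`. -/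
noncomputable def F3Fn (n : ℕ) (t η : ℝ) : ℝ :=
  Real.exp (phiFn n t) *
    (Real.exp ((Real.exp η - 1) * (2 * t + phiFn n t))
      - (Real.exp η - 1) * (2 * t + phiFn n t) - 1)

/-- `F(t, η) = F₁(t)·η + F₂(t, η) + F₃(t, η) + F₀(t)`. -/
noncomputable def FFn (n : ℕ) (t η : ℝ) : ℝ :=
  F1Fn n t * η + F2Fn n t η + F3Fn n t η + F0Fn n t

/-- `μ = √((n-2)(10-n))`. -/
noncomputable def muFn (n : ℕ) : ℝ := Real.sqrt (((n : ℝ) - 2) * (10 - (n : ℝ)))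

/-- The integral operator
`Ψ[η](t) = -(1/μ) e^{(n-2)t/2} ∫_t^∞ e^{-(n-2)s/2} sin(μ(s-t)) F(s, η(s)) ds`. -/
noncomputable def PsiOp (n : ℕ) (η : ℝ → ℝ) (t : ℝ) : ℝ :=
  -(1 / muFn n) * Real.exp (((n : ℝ) - 2) * t / 2) *
    ∫ s in Set.Ioi t,
      Real.exp (-(((n : ℝ) - 2) * s) / 2) * Real.sin (muFn n * (s - t)) * FFn n s (η s)

/-- The closed ball `Σ_M` in the weighted space `X_T`: continuous functions on `(T, ∞)`
with `sup_{t > T} t² |η(t)| ≤ M`. -/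
def SigmaSet (T M : ℝ) : Set (ℝ → ℝ) :=
  {η | ContinuousOn η (Set.Ioi T) ∧ ∀ t > T, t ^ 2 * |η t| ≤ M}

open Filter Topology

theorem exp_sub_id_sub_one_sub_le {r x y : ℝ} (hr : r ≤ 1) (hx : |x| ≤ r) (hy : |y| ≤ r) :
    |(Real.exp x - x - 1) - (Real.exp y - y - 1)| ≤ 2 * r * |x - y| := by
  have hd : ∀ z ∈ Set.Icc (-r) r, HasDerivWithinAt (fun z : ℝ => Real.exp z - z - 1)
      (Real.exp z - 1) (Set.Icc (-r) r) z := fun z _ =>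
    (((Real.hasDerivAt_exp z).sub (hasDerivAt_id z)).sub_const 1).hasDerivWithinAt
  have hb : ∀ z ∈ Set.Icc (-r) r, ‖Real.exp z - 1‖ ≤ 2 * r := fun z hz => by
    have hz' : |z| ≤ r := abs_le.2 hz
    have := Real.abs_exp_sub_one_le (hz'.trans hr)
    rw [Real.norm_eq_abs]
    linarith
  exact (convex_Icc (-r) r).norm_image_sub_le_of_norm_hasDerivWithin_le hd hb
    (abs_le.1 hy) (abs_le.1 hx)

theorem abs_exp_sub_exp_le {x y : ℝ} (hx : |x| ≤ 1) (hy : |y| ≤ 1) :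
    |Real.exp x - Real.exp y| ≤ 3 * |x - y| := by
  have h := exp_sub_id_sub_one_sub_le le_rfl hx hy
  have h2 := abs_add_le ((Real.exp x - x - 1) - (Real.exp y - y - 1)) (x - y)
  rw [show (Real.exp x - x - 1) - (Real.exp y - y - 1) + (x - y) = Real.exp x - Real.exp y by
    ring] at h2
  linarith

theorem one_le_natCast_sub_two {n : ℕ} (hn : 3 ≤ n) : (1 : ℝ) ≤ (n : ℝ) - 2 := by
  have : (3 : ℝ) ≤ n := by exact_mod_cast hn
  linarith

theorem one_le_one_add_log_div {t : ℝ} (ht : 1 < t) : 1 ≤ 1 + Real.log t / (2 * t) := by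
  have : 0 ≤ Real.log t / (2 * t) := div_nonneg (Real.log_nonneg ht.le) (by linarith)
  linarith

theorem phiFn_eq {n : ℕ} (hn : 3 ≤ n) {t : ℝ} (ht : 1 < t) :
    phiFn n t = Real.log ((n : ℝ) - 2) - Real.log t + Real.log (1 + Real.log t / (2 * t)) := by
  have := one_le_natCast_sub_two hn
  rw [phiFn, Real.log_div (by linarith) (by linarith)]

theorem exp_phiFn {n : ℕ} (hn : 3 ≤ n) {t : ℝ} (ht : 1 < t) :
    Real.exp (phiFn n t) = ((n : ℝ) - 2) / t * (1 + Real.log t / (2 * t)) := by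
  have := one_le_natCast_sub_two hn
  have := one_le_one_add_log_div ht
  rw [phiFn, Real.exp_add, Real.exp_log (div_pos (by linarith) (by linarith)),
    Real.exp_log (by linarith)]

theorem le_two_mul_add_phiFn {n : ℕ} (hn : 3 ≤ n) {t : ℝ} (ht : 1 < t) :
    t ≤ 2 * t + phiFn n t := by
  have h1 := Real.log_nonneg (one_le_natCast_sub_two hn)
  have h2 := Real.log_nonneg (one_le_one_add_log_div ht)
  have h3 := Real.log_le_sub_one_of_pos (by linarith : 0 < t)
  rw [phiFn_eq hn ht]
  linarith

/-- The derivative of `phiFn n` on `(1, ∞)`. -/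
noncomputable def phiDeriv (t : ℝ) : ℝ :=
  -t⁻¹ + ((1 - Real.log t) / (2 * t ^ 2)) / (1 + Real.log t / (2 * t))

/-- The second derivative of `phiFn n` on `(1, ∞)`. -/
noncomputable def phiDerivTwo (t : ℝ) : ℝ :=
  (t ^ 2)⁻¹ + ((2 * Real.log t - 3) / (2 * t ^ 3)) / (1 + Real.log t / (2 * t))
    - (((1 - Real.log t) / (2 * t ^ 2)) / (1 + Real.log t / (2 * t))) ^ 2

theorem hasDerivAt_one_add_log_div {t : ℝ} (ht : 1 < t) :
    HasDerivAt (fun s => 1 + Real.log s / (2 * s)) ((1 - Real.log t) / (2 * t ^ 2)) t := by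
  have h0 : t ≠ 0 := by linarith
  have h := (((Real.hasDerivAt_log h0).div ((hasDerivAt_id t).const_mul 2)
    (by simpa using h0)).const_add 1)
  refine h.congr_deriv ?_
  simp only [id]
  field_simp

theorem hasDerivAt_phiFn {n : ℕ} (hn : 3 ≤ n) {t : ℝ} (ht : 1 < t) :
    HasDerivAt (phiFn n) (phiDeriv t) t := by
  have h0 : t ≠ 0 := by linarith
  have h1 := one_le_one_add_log_div ht
  have h := ((Real.hasDerivAt_log h0).const_sub (Real.log ((n : ℝ) - 2))).add
    ((hasDerivAt_one_add_log_div ht).log (by linarith))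
  refine h.congr_of_eventuallyEq ?_
  filter_upwards [lt_mem_nhds ht] with s hs
  exact phiFn_eq hn hs

theorem hasDerivAt_phiDeriv {t : ℝ} (ht : 1 < t) :
    HasDerivAt phiDeriv (phiDerivTwo t) t := by
  have h0 : t ≠ 0 := by linarith
  have h1 : 1 + Real.log t / (2 * t) ≠ 0 := by linarith [one_le_one_add_log_div ht]
  have hN : HasDerivAt (fun s => (1 - Real.log s) / (2 * s ^ 2))
      ((2 * Real.log t - 3) / (2 * t ^ 3)) t := by
    have h := ((Real.hasDerivAt_log h0).const_sub 1).div ((hasDerivAt_pow 2 t).const_mul 2)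
      (by positivity)
    refine h.congr_deriv ?_
    field_simp
    ring
  have h := (hasDerivAt_inv h0).neg.add (hN.div (hasDerivAt_one_add_log_div ht) h1)
  refine h.congr_deriv ?_
  rw [phiDerivTwo]
  generalize 1 + Real.log t / (2 * t) = u at h1
  field_simp
  ring

theorem deriv_fFn {n : ℕ} (hn : 3 ≤ n) {t : ℝ} (ht : 1 < t) :
    deriv (fFn n) t = (2 + phiDeriv t) / (2 * t + phiFn n t) := by
  have h1 := le_two_mul_add_phiFn hn ht
  have h := (((hasDerivAt_id t).const_mul 2).add (hasDerivAt_phiFn hn ht)).log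
    (by simp only [id, Pi.add_apply]; linarith)
  rw [mul_one] at h
  exact h.deriv

theorem deriv_deriv_fFn {n : ℕ} (hn : 3 ≤ n) {t : ℝ} (ht : 1 < t) :
    deriv (deriv (fFn n)) t = phiDerivTwo t / (2 * t + phiFn n t)
      - ((2 + phiDeriv t) / (2 * t + phiFn n t)) ^ 2 := by
  have h1 := le_two_mul_add_phiFn hn ht
  have h2 : 2 * t + phiFn n t ≠ 0 := by linarith
  have he : deriv (fFn n) =ᶠ[nhds t] fun s => (2 + phiDeriv s) / (2 * s + phiFn n s) := by
    filter_upwards [lt_mem_nhds ht] with s hs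
    exact deriv_fFn hn hs
  have h := ((hasDerivAt_phiDeriv ht).const_add 2).div
    (((hasDerivAt_id t).const_mul 2).add (hasDerivAt_phiFn hn ht))
    (by simpa only [id, Pi.add_apply] using h2)
  rw [he.deriv_eq]
  refine h.deriv.trans ?_
  simp only [id, Pi.add_apply]
  field_simp

theorem continuousOn_phiFn {n : ℕ} (hn : 3 ≤ n) : ContinuousOn (phiFn n) (Set.Ioi 1) :=
  fun _ ht => (hasDerivAt_phiFn hn ht).continuousAt.continuousWithinAt

theorem continuousOn_phiDeriv : ContinuousOn phiDeriv (Set.Ioi 1) :=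
  fun _ ht => (hasDerivAt_phiDeriv ht).continuousAt.continuousWithinAt

theorem continuousOn_phiDerivTwo : ContinuousOn phiDerivTwo (Set.Ioi 1) := by
  have h0 : ∀ t ∈ Set.Ioi (1 : ℝ), t ≠ 0 := fun t ht => by
    have : (1 : ℝ) < t := ht
    linarith
  have h1 : ∀ t ∈ Set.Ioi (1 : ℝ), 1 + Real.log t / (2 * t) ≠ 0 := fun t ht => by
    linarith [one_le_one_add_log_div ht]
  have hl : ContinuousOn Real.log (Set.Ioi 1) := fun t ht =>
    (Real.continuousAt_log (h0 t ht)).continuousWithinAt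
  have hu : ContinuousOn (fun t => 1 + Real.log t / (2 * t)) (Set.Ioi 1) :=
    fun t ht => (hasDerivAt_one_add_log_div ht).continuousAt.continuousWithinAt
  have hp : ∀ k : ℕ, ∀ t ∈ Set.Ioi (1 : ℝ), 2 * t ^ k ≠ 0 := fun k t ht =>
    mul_ne_zero two_ne_zero (pow_ne_zero k (h0 t ht))
  refine ((ContinuousOn.inv₀ (by fun_prop) fun t ht => pow_ne_zero 2 (h0 t ht)).add
    (ContinuousOn.div (ContinuousOn.div (by fun_prop) (by fun_prop) (hp 3)) hu h1)).sub
    ((ContinuousOn.div (ContinuousOn.div (by fun_prop) (by fun_prop) (hp 2)) hu h1).pow 2)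

theorem continuousOn_F0Fn {n : ℕ} (hn : 3 ≤ n) : ContinuousOn (F0Fn n) (Set.Ioi 1) := by
  have hphi := continuousOn_phiFn hn
  have h1 := continuousOn_phiDeriv
  have h2 := continuousOn_phiDerivTwo
  have hD : ∀ t ∈ Set.Ioi (1 : ℝ), 2 * t + phiFn n t ≠ 0 := fun t ht => by
    have := le_two_mul_add_phiFn hn ht
    have : (1 : ℝ) < t := ht
    linarith
  have hc : ContinuousOn (fun t => Real.exp (phiFn n t) + (phiDerivTwo t / (2 * t + phiFn n t)
      - ((2 + phiDeriv t) / (2 * t + phiFn n t)) ^ 2)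
      - ((n : ℝ) - 2) * ((2 + phiDeriv t) / (2 * t + phiFn n t))) (Set.Ioi 1) := by
    have hq : ContinuousOn (fun t => (2 + phiDeriv t) / (2 * t + phiFn n t)) (Set.Ioi 1) :=
      ContinuousOn.div (by fun_prop) (by fun_prop) hD
    have hr : ContinuousOn (fun t => phiDerivTwo t / (2 * t + phiFn n t)) (Set.Ioi 1) :=
      ContinuousOn.div (by fun_prop) (by fun_prop) hD
    fun_prop
  refine hc.congr fun t ht => ?_
  rw [F0Fn, deriv_deriv_fFn hn ht, deriv_fFn hn ht]

theorem continuousOn_FFn {n : ℕ} (hn : 3 ≤ n) {T : ℝ} (hT : 1 ≤ T) {η : ℝ → ℝ}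
    (hη : ContinuousOn η (Set.Ioi T)) : ContinuousOn (fun s => FFn n s (η s)) (Set.Ioi T) := by
  have hphi := (continuousOn_phiFn hn).mono (Set.Ioi_subset_Ioi hT)
  have h0 := (continuousOn_F0Fn hn).mono (Set.Ioi_subset_Ioi hT)
  unfold FFn F1Fn F2Fn F3Fn
  fun_prop

theorem tendsto_log_div : Tendsto (fun t : ℝ => Real.log t / t) atTop (𝓝 0) := by
  simpa using Real.tendsto_pow_log_div_mul_add_atTop 1 0 1 one_ne_zero

theorem tendsto_log_div_two_mul :
    Tendsto (fun t : ℝ => Real.log t / (2 * t)) atTop (𝓝 0) := by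
  simpa using Real.tendsto_pow_log_div_mul_add_atTop 2 0 1 two_ne_zero

theorem tendsto_one_add_log_div :
    Tendsto (fun t : ℝ => 1 + Real.log t / (2 * t)) atTop (𝓝 1) := by
  simpa using tendsto_log_div_two_mul.const_add 1

theorem tendsto_log_one_add_log_div :
    Tendsto (fun t : ℝ => Real.log (1 + Real.log t / (2 * t))) atTop (𝓝 0) := by
  simpa using tendsto_one_add_log_div.log one_ne_zero

/-- The defect in the leading-order balance `t e^φ (2t + φ) / (n - 2) ≈ 2t`. -/
theorem tendsto_one_add_mul_sub {n : ℕ} (hn : 3 ≤ n) :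
    Tendsto (fun t : ℝ => (1 + Real.log t / (2 * t)) * (2 * t + phiFn n t) - 2 * t) atTop
      (𝓝 (Real.log ((n : ℝ) - 2))) := by
  have h1 : Tendsto (fun t : ℝ => Real.log t ^ 2 / (2 * t)) atTop (𝓝 0) := by
    simpa using Real.tendsto_pow_log_div_mul_add_atTop 2 0 2 two_ne_zero
  have h := h1.neg.add (tendsto_one_add_log_div.mul
    (tendsto_log_one_add_log_div.const_add (Real.log ((n : ℝ) - 2))))
  simp only [neg_zero, add_zero, zero_add, one_mul] at h
  refine h.congr' ?_
  filter_upwards [eventually_gt_atTop 1] with t ht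
  have : t ≠ 0 := by linarith
  rw [phiFn_eq hn ht]
  generalize Real.log (1 + Real.log t / (2 * t)) = v
  field_simp
  ring

theorem tendsto_id_mul_log_div_sq :
    Tendsto (fun t : ℝ => t * (((1 - Real.log t) / (2 * t ^ 2)) / (1 + Real.log t / (2 * t))))
      atTop (𝓝 0) := by
  have h := ((tendsto_inv_atTop_zero.div_const 2).sub tendsto_log_div_two_mul).div
    tendsto_one_add_log_div one_ne_zero
  simp only [zero_div, sub_zero] at h
  refine h.congr' ?_
  filter_upwards [eventually_gt_atTop 1] with t ht
  have h0 : t ≠ 0 := by linarith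
  have h1 : 1 + Real.log t / (2 * t) ≠ 0 := by linarith [one_le_one_add_log_div ht]
  simp only [Pi.div_apply]
  generalize 1 + Real.log t / (2 * t) = u at h1
  field_simp

theorem tendsto_id_mul_phiDeriv : Tendsto (fun t => t * phiDeriv t) atTop (𝓝 (-1)) := by
  have h := tendsto_id_mul_log_div_sq.const_add (-1)
  rw [add_zero] at h
  refine h.congr' ?_
  filter_upwards [eventually_gt_atTop 1] with t ht
  have h0 : t ≠ 0 := by linarith
  rw [phiDeriv, mul_add, mul_neg, mul_inv_cancel₀ h0]

theorem tendsto_phiDeriv : Tendsto phiDeriv atTop (𝓝 0) := by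
  have h := tendsto_id_mul_phiDeriv.mul tendsto_inv_atTop_zero
  rw [mul_zero] at h
  refine h.congr' ?_
  filter_upwards [eventually_gt_atTop 1] with t ht
  have h0 : t ≠ 0 := by linarith
  field_simp

theorem tendsto_id_mul_phiDerivTwo : Tendsto (fun t => t * phiDerivTwo t) atTop (𝓝 0) := by
  have hi := tendsto_inv_atTop_zero (𝕜 := ℝ)
  have ha := ((tendsto_log_div.mul hi).sub ((hi.mul hi).const_mul (3 / 2))).div
    tendsto_one_add_log_div one_ne_zero
  have h := (hi.add ha).sub ((tendsto_id_mul_log_div_sq.pow 2).mul hi)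
  simp only [mul_zero, sub_zero, zero_div, add_zero] at h
  refine h.congr' ?_
  filter_upwards [eventually_gt_atTop 1] with t ht
  have h0 : t ≠ 0 := by linarith
  have h1 : 1 + Real.log t / (2 * t) ≠ 0 := by linarith [one_le_one_add_log_div ht]
  simp only [Pi.div_apply, phiDerivTwo]
  generalize 1 + Real.log t / (2 * t) = u at h1
  field_simp

theorem eventually_two_mul_add_phiFn_le {n : ℕ} (hn : 3 ≤ n) :
    ∀ᶠ t in atTop, 2 * t + phiFn n t ≤ 3 * t := by
  filter_upwards [eventually_gt_atTop 1, eventually_ge_atTop (Real.log ((n : ℝ) - 2) + 1),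
    (tendsto_one_add_mul_sub hn).eventually_le_const (lt_add_one _)] with t ht h1 h2
  have h3 := le_two_mul_add_phiFn hn ht
  nlinarith [one_le_one_add_log_div ht]

theorem eventually_exp_phiFn_le {n : ℕ} (hn : 3 ≤ n) :
    ∀ᶠ t in atTop, Real.exp (phiFn n t) ≤ 2 * ((n : ℝ) - 2) / t := by
  filter_upwards [eventually_gt_atTop 1,
    tendsto_one_add_log_div.eventually_le_const one_lt_two] with t ht h
  have hm := one_le_natCast_sub_two hn
  rw [exp_phiFn hn ht, mul_comm 2 ((n : ℝ) - 2), mul_div_right_comm]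
  have hmt : 0 ≤ ((n : ℝ) - 2) / t := div_nonneg (by linarith) (by linarith)
  exact mul_le_mul_of_nonneg_left h hmt

theorem tendsto_F1Fn {n : ℕ} (hn : 3 ≤ n) : Tendsto (F1Fn n) atTop (𝓝 0) := by
  have h := ((tendsto_one_add_mul_sub hn).mul tendsto_inv_atTop_zero).const_mul ((n : ℝ) - 2)
  simp only [mul_zero] at h
  refine h.congr' ?_
  filter_upwards [eventually_gt_atTop 1] with t ht
  have h0 : t ≠ 0 := by linarith
  rw [F1Fn, exp_phiFn hn ht]
  generalize 1 + Real.log t / (2 * t) = u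
  field_simp

theorem exists_abs_F0Fn_le {n : ℕ} (hn : 3 ≤ n) :
    ∃ C > 0, ∀ᶠ t in atTop, |F0Fn n t| ≤ C / t ^ 2 := by
  set m : ℝ := (n : ℝ) - 2 with hm
  have hm1 : 1 ≤ m := one_le_natCast_sub_two hn
  set b : ℝ := |Real.log m + 1| + 1
  have hA : Tendsto (fun t : ℝ => (1 + Real.log t / (2 * t)) * (2 * t + phiFn n t) - 2 * t
      - t * phiDeriv t) atTop (𝓝 (Real.log m - (-1))) :=
    (tendsto_one_add_mul_sub hn).sub tendsto_id_mul_phiDeriv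
  rw [sub_neg_eq_add] at hA
  refine ⟨m * b + 1 + 9, by positivity, ?_⟩
  filter_upwards [eventually_gt_atTop 1, hA.abs.eventually_le_const (lt_add_one _),
    tendsto_id_mul_phiDerivTwo.abs.eventually_le_const (by simp : |(0 : ℝ)| < 1),
    tendsto_phiDeriv.abs.eventually_le_const (by simp : |(0 : ℝ)| < 1)] with t ht h1 h2 h3
  have h0 : 0 < t := by linarith
  have hD := le_two_mul_add_phiFn hn ht
  rw [F0Fn, deriv_deriv_fFn hn ht, deriv_fFn hn ht, exp_phiFn hn ht, ← hm]
  generalize 2 * t + phiFn n t = D at *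
  generalize 1 + Real.log t / (2 * t) = u at *
  have hD0 : 0 < D := by linarith
  have e : m / t * u + (phiDerivTwo t / D - ((2 + phiDeriv t) / D) ^ 2)
      - m * ((2 + phiDeriv t) / D)
      = m * (u * D - 2 * t - t * phiDeriv t) / (t * D) + t * phiDerivTwo t / (t * D)
        - ((2 + phiDeriv t) / D) ^ 2 := by
    field_simp
    ring
  have i1 : |m * (u * D - 2 * t - t * phiDeriv t) / (t * D)| ≤ m * b / t ^ 2 := by
    rw [abs_div, abs_mul, abs_of_pos (by linarith : 0 < m), abs_of_pos (by positivity : 0 < t * D)]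
    gcongr
    nlinarith
  have i2 : |t * phiDerivTwo t / (t * D)| ≤ 1 / t ^ 2 := by
    rw [abs_div, abs_of_pos (by positivity : 0 < t * D)]
    gcongr
    nlinarith
  have i3 : |((2 + phiDeriv t) / D) ^ 2| ≤ 9 / t ^ 2 := by
    rw [abs_pow, abs_div, abs_of_pos hD0, div_pow, show (9 : ℝ) = 3 ^ 2 by norm_num]
    gcongr
    have := abs_add_le 2 (phiDeriv t)
    rw [abs_two] at this
    linarith
  rw [e, add_div (m * b + 1), add_div (m * b)]
  exact (abs_sub _ _).trans (add_le_add ((abs_add_le _ _).trans (add_le_add i1 i2)) i3)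

/-- On the ball `t² |x| ≤ M`, the map `x ↦ F(t, x)` has small Lipschitz constant for large `t`. -/
theorem eventually_abs_FFn_sub_le {n : ℕ} (hn : 3 ≤ n) {M ε : ℝ} (hM : 0 < M) (hε : 0 < ε) :
    ∀ᶠ t in atTop, ∀ x y : ℝ, t ^ 2 * |x| ≤ M → t ^ 2 * |y| ≤ M →
      |FFn n t x - FFn n t y| ≤ ε * |x - y| := by
  set m : ℝ := (n : ℝ) - 2 with hm
  have hm1 : 1 ≤ m := one_le_natCast_sub_two hn
  have hlim : Tendsto (fun t : ℝ => |F1Fn n t| + 12 * m * M * (t⁻¹ * t⁻¹) + 216 * m * M * t⁻¹)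
      atTop (𝓝 0) := by
    have hi := tendsto_inv_atTop_zero (𝕜 := ℝ)
    simpa using ((tendsto_F1Fn hn).abs.add ((hi.mul hi).const_mul (12 * m * M))).add
      (hi.const_mul (216 * m * M))
  filter_upwards [eventually_gt_atTop 1, eventually_ge_atTop (6 * M),
    eventually_two_mul_add_phiFn_le hn, eventually_exp_phiFn_le hn,
    hlim.eventually_le_const hε] with t ht hMt hDle hexp hsmall x y hx hy
  have h0 : 0 < t := by linarith
  have hD := le_two_mul_add_phiFn hn ht
  have hEpos := Real.exp_pos (phiFn n t)
  rw [← hm] at hexp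
  simp only [FFn, F2Fn, F3Fn]
  generalize 2 * t + phiFn n t = D at *
  generalize Real.exp (phiFn n t) = E at *
  have hD0 : 0 < D := by linarith
  have hr1 : M / t ^ 2 ≤ 1 := by
    rw [div_le_one (by positivity)]
    nlinarith
  have hR1 : 6 * M / t ≤ 1 := (div_le_one h0).2 hMt
  have hsmall' : ∀ z, t ^ 2 * |z| ≤ M → |z| ≤ M / t ^ 2 := fun z hz => by
    rw [le_div_iff₀ (by positivity)]
    linarith
  have hX : ∀ z, t ^ 2 * |z| ≤ M → |(Real.exp z - 1) * D| ≤ 6 * M / t := fun z hz => by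
    have hz1 := hsmall' z hz
    rw [abs_mul, abs_of_pos hD0]
    calc |Real.exp z - 1| * D ≤ (2 * (M / t ^ 2)) * (3 * t) := by
          gcongr
          exact (Real.abs_exp_sub_one_le (hz1.trans hr1)).trans (by linarith)
      _ = 6 * M / t := by field_simp; ring
  have hdX : |(Real.exp x - 1) * D - (Real.exp y - 1) * D| ≤ 9 * t * |x - y| := by
    rw [← sub_mul, abs_mul, abs_of_pos hD0, sub_sub_sub_cancel_right]
    calc |Real.exp x - Real.exp y| * D ≤ (3 * |x - y|) * (3 * t) := by
          gcongr
          exact abs_exp_sub_exp_le ((hsmall' x hx).trans hr1) ((hsmall' y hy).trans hr1)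
      _ = 9 * t * |x - y| := by ring
  have h2 : |E * (Real.exp x - x - 1) * D - E * (Real.exp y - y - 1) * D|
      ≤ 12 * m * M * (t⁻¹ * t⁻¹) * |x - y| := by
    rw [show E * (Real.exp x - x - 1) * D - E * (Real.exp y - y - 1) * D
      = E * D * ((Real.exp x - x - 1) - (Real.exp y - y - 1)) by ring, abs_mul,
      abs_of_pos (by positivity : 0 < E * D)]
    calc _ ≤ (2 * m / t) * (3 * t) * (2 * (M / t ^ 2) * |x - y|) := by
          gcongr
          exact exp_sub_id_sub_one_sub_le hr1 (hsmall' x hx) (hsmall' y hy)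
      _ = _ := by field_simp; ring
  have h3 := exp_sub_id_sub_one_sub_le hR1 (hX x hx) (hX y hy)
  have h4 : |E * (Real.exp ((Real.exp x - 1) * D) - (Real.exp x - 1) * D - 1)
      - E * (Real.exp ((Real.exp y - 1) * D) - (Real.exp y - 1) * D - 1)|
      ≤ 216 * m * M * t⁻¹ * |x - y| := by
    rw [← mul_sub, abs_mul, abs_of_pos hEpos]
    calc _ ≤ (2 * m / t) * (2 * (6 * M / t) * (9 * t * |x - y|)) := by
          gcongr
          exact h3.trans (by gcongr)
      _ = _ := by field_simp; ring
  have h5 : |F1Fn n t * x - F1Fn n t * y| = |F1Fn n t| * |x - y| := by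
    rw [← mul_sub, abs_mul]
  have h6 := mul_le_mul_of_nonneg_right hsmall (abs_nonneg (x - y))
  rw [add_mul, add_mul] at h6
  refine le_trans ?_ h6
  rw [← h5]
  refine le_trans (le_of_eq ?_) ((abs_add_three _ _ _).trans (add_le_add_three le_rfl h2 h4))
  congr 1
  ring

theorem FFn_zero (n : ℕ) (t : ℝ) : FFn n t 0 = F0Fn n t := by
  simp [FFn, F2Fn, F3Fn]

/-- The convolution kernel of `PsiOp n`, in the shifted variable `r = s - t`. -/
noncomputable def psiKernel (n : ℕ) (r : ℝ) : ℝ :=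
  Real.exp (-(((n : ℝ) - 2) / 2) * r) * Real.sin (muFn n * r)

theorem continuous_psiKernel (n : ℕ) : Continuous (psiKernel n) := by
  unfold psiKernel
  fun_prop

theorem abs_psiKernel_le (n : ℕ) (r : ℝ) :
    |psiKernel n r| ≤ Real.exp (-(((n : ℝ) - 2) / 2) * r) := by
  rw [psiKernel, abs_mul, abs_of_pos (Real.exp_pos _)]
  exact mul_le_of_le_one_right (Real.exp_pos _).le (Real.abs_sin_le_one _)

theorem PsiOp_eq (n : ℕ) (η : ℝ → ℝ) (t : ℝ) :
    PsiOp n η t =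
      -(1 / muFn n) * ∫ r in Set.Ioi 0, psiKernel n r * FFn n (t + r) (η (t + r)) := by
  rw [PsiOp, mul_assoc, ← integral_const_mul]
  congr 1
  have h := (measurePreserving_add_left volume t).setIntegral_preimage_emb
    (measurableEmbedding_addLeft t)
    (fun s => Real.exp (((n : ℝ) - 2) * t / 2) *
      (Real.exp (-(((n : ℝ) - 2) * s) / 2) * Real.sin (muFn n * (s - t)) * FFn n s (η s)))
    (Set.Ioi t)
  rw [← h, Set.preimage_const_add_Ioi, sub_self]
  refine integral_congr_ae (Filter.Eventually.of_forall fun r => ?_)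
  simp only [psiKernel, add_sub_cancel_left]
  rw [← mul_assoc, ← mul_assoc, ← Real.exp_add]
  congr 3
  ring

section Kernel

variable {n : ℕ} {G : ℝ → ℝ} {C T t : ℝ}

theorem integrableOn_exp_mul (hn : 3 ≤ n) (c : ℝ) :
    IntegrableOn (fun r => Real.exp (-(((n : ℝ) - 2) / 2) * r) * c) (Set.Ioi 0) :=
  (exp_neg_integrableOn_Ioi 0 (by linarith [one_le_natCast_sub_two hn])).mul_const c

theorem aestronglyMeasurable_psiKernel_mul (hG : ContinuousOn G (Set.Ioi T)) (ht : T < t) :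
    AEStronglyMeasurable (fun r => psiKernel n r * G (t + r)) (volume.restrict (Set.Ioi 0)) := by
  refine ContinuousOn.aestronglyMeasurable ?_ measurableSet_Ioi
  refine (continuous_psiKernel n).continuousOn.mul
    (hG.comp (by fun_prop) fun r hr => ?_)
  simp only [Set.mem_Ioi] at hr ⊢
  linarith

theorem abs_psiKernel_mul_le (hT : 0 < T) (hC : ∀ s > T, |G s| ≤ C / s ^ 2) {τ r : ℝ}
    (hτ : 0 < τ) (hτt : τ ≤ t) (ht : T < t) (hr : 0 < r) :
    |psiKernel n r * G (t + r)| ≤ Real.exp (-(((n : ℝ) - 2) / 2) * r) * (C / τ ^ 2) := by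
  have h := hC (t + r) (by linarith)
  have hC0 : 0 ≤ C := by
    by_contra! hneg
    have : C / (t + r) ^ 2 < 0 := div_neg_of_neg_of_pos hneg (by nlinarith)
    linarith [abs_nonneg (G (t + r))]
  rw [abs_mul]
  refine mul_le_mul (abs_psiKernel_le n r) (h.trans ?_) (abs_nonneg _) (Real.exp_pos _).le
  gcongr
  linarith

theorem integrableOn_psiKernel_mul (hn : 3 ≤ n) (hT : 0 < T) (hG : ContinuousOn G (Set.Ioi T))
    (hC : ∀ s > T, |G s| ≤ C / s ^ 2) (ht : T < t) :
    IntegrableOn (fun r => psiKernel n r * G (t + r)) (Set.Ioi 0) := by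
  refine Integrable.mono' (integrableOn_exp_mul hn (C / t ^ 2))
    (aestronglyMeasurable_psiKernel_mul hG ht) ?_
  filter_upwards [ae_restrict_mem measurableSet_Ioi] with r hr
  exact abs_psiKernel_mul_le hT hC (hT.trans ht) le_rfl ht hr

theorem abs_integral_psiKernel_mul_le (hn : 3 ≤ n) (hT : 0 < T)
    (hC : ∀ s > T, |G s| ≤ C / s ^ 2) (ht : T < t) :
    |∫ r in Set.Ioi 0, psiKernel n r * G (t + r)| ≤ 2 / ((n : ℝ) - 2) * (C / t ^ 2) := by
  have hm := one_le_natCast_sub_two hn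
  have h := norm_integral_le_of_norm_le (integrableOn_exp_mul hn (C / t ^ 2))
    (f := fun r => psiKernel n r * G (t + r)) (by
      filter_upwards [ae_restrict_mem measurableSet_Ioi] with r hr
      exact abs_psiKernel_mul_le hT hC (hT.trans ht) le_rfl ht hr)
  refine h.trans (le_of_eq ?_)
  rw [integral_mul_const, integral_exp_mul_Ioi (by linarith) 0]
  simp

theorem continuousOn_integral_psiKernel_mul (hn : 3 ≤ n) (hT : 0 < T)
    (hG : ContinuousOn G (Set.Ioi T)) (hC : ∀ s > T, |G s| ≤ C / s ^ 2) :
    ContinuousOn (fun t => ∫ r in Set.Ioi 0, psiKernel n r * G (t + r)) (Set.Ioi T) := by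
  refine continuousOn_of_dominated
    (bound := fun r => Real.exp (-(((n : ℝ) - 2) / 2) * r) * (C / T ^ 2))
    (fun t ht => aestronglyMeasurable_psiKernel_mul hG ht) (fun t ht => ?_)
    (integrableOn_exp_mul hn _) ?_
  · filter_upwards [ae_restrict_mem measurableSet_Ioi] with r hr
    exact abs_psiKernel_mul_le hT hC hT (le_of_lt ht) ht hr
  · filter_upwards [ae_restrict_mem measurableSet_Ioi] with r hr
    refine continuousOn_const.mul (hG.comp (by fun_prop) fun t ht => ?_)
    simp only [Set.mem_Ioi] at hr ht ⊢
    linarith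

end Kernel

theorem muFn_pos {n : ℕ} (hn1 : 3 ≤ n) (hn2 : n ≤ 9) : 0 < muFn n := by
  have h1 := one_le_natCast_sub_two hn1
  have h2 : (n : ℝ) ≤ 9 := by exact_mod_cast hn2
  exact Real.sqrt_pos.2 (mul_pos (by linarith) (by linarith))

/-- Lemma 2.1: for `3 ≤ n ≤ 9` there exist `M, T > 0` such that
`Ψ(Σ_M) ⊆ Σ_M` and `Ψ : Σ_M → Σ_M` is a contraction for the norm
`‖η‖ = sup_{t > T} t² |η(t)|`. -/
theorem Psi_contraction (n : ℕ) (hn1 : 3 ≤ n) (hn2 : n ≤ 9) :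
    ∃ M > (0 : ℝ), ∃ T > (0 : ℝ),
      (∀ η ∈ SigmaSet T M, PsiOp n η ∈ SigmaSet T M) ∧
      ∃ q : ℝ, 0 ≤ q ∧ q < 1 ∧
        ∀ η₁ ∈ SigmaSet T M, ∀ η₂ ∈ SigmaSet T M,
          (⨆ t : Set.Ioi T, (t : ℝ) ^ 2 * |PsiOp n η₁ t - PsiOp n η₂ t|)
            ≤ q * ⨆ t : Set.Ioi T, (t : ℝ) ^ 2 * |η₁ t - η₂ t| := by
  have hm := one_le_natCast_sub_two hn1
  have hμ := muFn_pos hn1 hn2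
  obtain ⟨C, hC, hF0⟩ := exists_abs_F0Fn_le hn1
  set A : ℝ := 1 / muFn n * (2 / ((n : ℝ) - 2)) with hA
  have hA0 : 0 < A := mul_pos (by positivity) (div_pos two_pos (by linarith))
  set M : ℝ := 2 * A * C with hMdef
  have hM : 0 < M := by positivity
  set ε : ℝ := 1 / (2 * A) with hεdef
  have hε : 0 < ε := by positivity
  obtain ⟨T₀, hT₀⟩ := Filter.eventually_atTop.1
    (hF0.and (eventually_abs_FFn_sub_le hn1 hM hε))
  set T : ℝ := max T₀ 1
  have hT1 : 1 ≤ T := le_max_right _ _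
  have hT : 0 < T := by linarith
  have hF0' : ∀ s > T, |F0Fn n s| ≤ C / s ^ 2 :=
    fun s hs => (hT₀ s ((le_max_left _ _).trans hs.le)).1
  have hLip : ∀ s > T, ∀ x y : ℝ, s ^ 2 * |x| ≤ M → s ^ 2 * |y| ≤ M →
      |FFn n s x - FFn n s y| ≤ ε * |x - y| :=
    fun s hs => (hT₀ s ((le_max_left _ _).trans hs.le)).2
  have hbound : ∀ η ∈ SigmaSet T M, ∀ s > T, |FFn n s (η s)| ≤ (2 * C) / s ^ 2 := by
    intro η hη s hs
    have hs0 : 0 < s := hT.trans hs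
    have h1 := hLip s hs (η s) 0 (hη.2 s hs) (by simpa using hM.le)
    rw [FFn_zero, sub_zero] at h1
    have h2 := hF0' s hs
    have h3 : ε * |η s| ≤ C / s ^ 2 := by
      rw [le_div_iff₀ (by positivity)]
      have h4 := mul_le_mul_of_nonneg_left (hη.2 s hs) hε.le
      have h5 : ε * M = C := by
        rw [hεdef, hMdef]
        field_simp
      linarith
    have h6 := abs_add_le (FFn n s (η s) - F0Fn n s) (F0Fn n s)
    rw [sub_add_cancel] at h6
    rw [two_mul, add_div]
    linarith
  have hcont : ∀ η ∈ SigmaSet T M, ContinuousOn (fun s => FFn n s (η s)) (Set.Ioi T) :=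
    fun η hη => continuousOn_FFn hn1 hT1 hη.1
  have hweight : ∀ (I K t : ℝ), 0 < t → |I| ≤ 2 / ((n : ℝ) - 2) * (K / t ^ 2) →
      t ^ 2 * |-(1 / muFn n) * I| ≤ A * K := by
    intro I K t ht hI
    rw [abs_mul, abs_neg, abs_of_pos (by positivity : 0 < 1 / muFn n)]
    calc _ ≤ t ^ 2 * (1 / muFn n * (2 / ((n : ℝ) - 2) * (K / t ^ 2))) := by gcongr
      _ = A * K := by
        rw [hA]
        field_simp
  have hmaps : ∀ η ∈ SigmaSet T M, PsiOp n η ∈ SigmaSet T M := by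
    intro η hη
    refine ⟨?_, fun t ht => ?_⟩
    · refine ContinuousOn.congr ?_ fun t _ => PsiOp_eq n η t
      exact continuousOn_const.mul
        (continuousOn_integral_psiKernel_mul hn1 hT (hcont η hη) (hbound η hη))
    · rw [PsiOp_eq]
      refine (hweight _ _ t (hT.trans ht)
        (abs_integral_psiKernel_mul_le hn1 hT (hbound η hη) ht)).trans (le_of_eq ?_)
      rw [hMdef]
      ring
  refine ⟨M, hM, T, hT, hmaps, 1 / 2, by norm_num, by norm_num, fun η₁ h₁ η₂ h₂ => ?_⟩
  have hbdd : BddAbove (Set.range fun t : Set.Ioi T => (t : ℝ) ^ 2 * |η₁ t - η₂ t|) := by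
    refine ⟨2 * M, ?_⟩
    rintro _ ⟨t, rfl⟩
    have i1 := h₁.2 t t.2
    have i2 := h₂.2 t t.2
    have i3 := mul_le_mul_of_nonneg_left (abs_sub (η₁ t) (η₂ t)) (sq_nonneg (t : ℝ))
    simp only
    linarith
  set S : ℝ := ⨆ t : Set.Ioi T, (t : ℝ) ^ 2 * |η₁ t - η₂ t|
  have hS : ∀ s > T, s ^ 2 * |η₁ s - η₂ s| ≤ S := fun s hs => le_ciSup hbdd ⟨s, hs⟩
  have hdiff : ∀ s > T, |FFn n s (η₁ s) - FFn n s (η₂ s)| ≤ (ε * S) / s ^ 2 := by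
    intro s hs
    have hs0 : 0 < s := hT.trans hs
    refine (hLip s hs _ _ (h₁.2 s hs) (h₂.2 s hs)).trans ?_
    rw [le_div_iff₀ (by positivity)]
    have := mul_le_mul_of_nonneg_left (hS s hs) hε.le
    linarith
  refine ciSup_le fun ⟨t, ht⟩ => ?_
  have hsub : PsiOp n η₁ t - PsiOp n η₂ t = -(1 / muFn n) * ∫ r in Set.Ioi 0,
      psiKernel n r * (FFn n (t + r) (η₁ (t + r)) - FFn n (t + r) (η₂ (t + r))) := by
    rw [PsiOp_eq, PsiOp_eq, ← mul_sub, ← integral_sub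
      (integrableOn_psiKernel_mul hn1 hT (hcont η₁ h₁) (hbound η₁ h₁) ht)
      (integrableOn_psiKernel_mul hn1 hT (hcont η₂ h₂) (hbound η₂ h₂) ht)]
    simp only [mul_sub]
  rw [hsub]
  refine (hweight _ _ t (hT.trans ht) (abs_integral_psiKernel_mul_le
    (G := fun s => FFn n s (η₁ s) - FFn n s (η₂ s)) hn1 hT hdiff ht)).trans (le_of_eq ?_)
  rw [hεdef]
  field_simp
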